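/- arXiv:2306.02040 — 7 statements merged into one kernel-verified Lean document; each statement's English description precedes it below -/
import Mathlib

section
/- There exist a number of agents n, a number of items m, an additive valuation profile, and an allocation x that is SD⁺efficient but not Pareto efficient. -/
/-- Utility of a 0/1 bundle under additive valuation `v`. -/
noncomputable def utility {m : ℕ} (v : Fin m → ℝ) (a : Fin m → Bool) : ℝ :=
  ∑ j : Fin m, if a j then v j else 0

/-- `p` ranks the items in decreasing order of value, with ties broken toward the item
with the smaller index. -/
def IsRanking {m : ℕ} (v : Fin m → ℝ) (p : Fin m ≃ Fin m) : Prop :=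
  ∀ k l : Fin m, k < l → v (p l) < v (p k) ∨ (v (p k) = v (p l) ∧ p k < p l)

/-- The number `m_i` of items with strictly positive value. -/
noncomputable def numPos {m : ℕ} (v : Fin m → ℝ) : ℕ :=
  (Finset.univ.filter fun j => 0 < v j).card

/-- The number of items among the top `l+1` positions of the ranking `p` (1-based positions
`1, …, l+1`) that are present in the bundle `a`. -/
def prefixCount {m : ℕ} (p : Fin m ≃ Fin m) (a : Fin m → Bool) (l : Fin m) : ℕ :=
  ∑ k ∈ Finset.univ.filter fun k => k ≤ l, if a (p k) then 1 else 0

/-- `a ⪰⁺_i b`: the prefix-sum inequality holds at every position `ℓ ∈ {1, …, m_i}`. -/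
noncomputable def SDPlusGE {m : ℕ} (v : Fin m → ℝ) (p : Fin m ≃ Fin m)
    (a b : Fin m → Bool) : Prop :=
  ∀ l : Fin m, (l : ℕ) < numPos v → prefixCount p b l ≤ prefixCount p a l

/-- A (deterministic, complete) allocation: every item is assigned to exactly one agent. -/
def IsAlloc {n m : ℕ} (x : Fin n → Fin m → Bool) : Prop :=
  ∀ j : Fin m, ∃! i : Fin n, x i j = true

/-- Allocation `y` stochastically and positively dominates allocation `x`:
`y_i ⪰⁺_i x_i` for every agent `i`, and `y_j ≻⁺_j x_j` (i.e. `y_j ⪰⁺_j x_j` and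
`y_j ≠ x_j`) for some agent `j`. -/
noncomputable def SDPlusDom {n m : ℕ} (v : Fin n → Fin m → ℝ)
    (p : Fin n → (Fin m ≃ Fin m)) (y x : Fin n → Fin m → Bool) : Prop :=
  (∀ i, SDPlusGE (v i) (p i) (y i) (x i)) ∧
    ∃ i, SDPlusGE (v i) (p i) (y i) (x i) ∧ y i ≠ x i

/-- An allocation is SD⁺efficient iff no allocation stochastically and positively
dominates it. -/
noncomputable def SDPlusEfficient {n m : ℕ} (v : Fin n → Fin m → ℝ)
    (p : Fin n → (Fin m ≃ Fin m)) (x : Fin n → Fin m → Bool) : Prop :=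
  ¬ ∃ y, IsAlloc y ∧ SDPlusDom v p y x

/-- An allocation is Pareto efficient iff no allocation weakly improves every agent's
utility and strictly improves some agent's utility. -/
noncomputable def ParetoEfficient {n m : ℕ} (v : Fin n → Fin m → ℝ)
    (x : Fin n → Fin m → Bool) : Prop :=
  ¬ ∃ y, IsAlloc y ∧ (∀ i, utility (v i) (x i) ≤ utility (v i) (y i)) ∧
    ∃ i, utility (v i) (x i) < utility (v i) (y i)

/-- Two agents who rank three positively valued items in the same order. -/
def sharedRankingValue (i : Fin 2) (j : Fin 3) : ℝ :=
  (![![4, 3, 2], ![6, 3, 2]] : Fin 2 → Fin 3 → ℝ) i j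

/-- The first agent gets the first item, the second agent gets the other two. -/
def topItemAlloc (i : Fin 2) (j : Fin 3) : Bool :=
  decide (i = 0 ↔ j = 0)

lemma sharedRankingValue_pos (i : Fin 2) (j : Fin 3) : 0 < sharedRankingValue i j := by
  fin_cases i <;> fin_cases j <;> norm_num [sharedRankingValue]

lemma numPos_sharedRankingValue (i : Fin 2) : numPos (sharedRankingValue i) = 3 := by
  simp [numPos, sharedRankingValue_pos]

lemma isRanking_sharedRankingValue (i : Fin 2) :
    IsRanking (sharedRankingValue i) (Equiv.refl _) := by
  intro k l hkl
  left
  fin_cases i <;> fin_cases k <;> fin_cases l <;>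
    first
    | exact absurd hkl (by decide)
    | norm_num [sharedRankingValue]

lemma isAlloc_fin_two_iff {m : ℕ} {x : Fin 2 → Fin m → Bool} :
    IsAlloc x ↔ ∀ j, x 1 j = !x 0 j := by
  refine forall_congr' fun j => ?_
  cases h₀ : x 0 j <;> cases h₁ : x 1 j <;>
    simp [ExistsUnique, Fin.exists_fin_two, Fin.forall_fin_two, h₀, h₁]

lemma isAlloc_topItemAlloc : IsAlloc topItemAlloc := by
  rw [isAlloc_fin_two_iff]
  decide

lemma isAlloc_not_topItemAlloc : IsAlloc fun i j => !topItemAlloc i j := by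
  rw [isAlloc_fin_two_iff]
  decide

/-- When both agents rank the items in their natural order, `topItemAlloc` is the only allocation
whose prefix counts are at least those of `topItemAlloc`. -/
lemma IsAlloc.eq_topItemAlloc {y : Fin 2 → Fin 3 → Bool} (hy : IsAlloc y)
    (h : ∀ i l, prefixCount (Equiv.refl _) (topItemAlloc i) l
      ≤ prefixCount (Equiv.refl _) (y i) l) : y = topItemAlloc := by
  rw [isAlloc_fin_two_iff] at hy
  revert y
  decide

lemma sdPlusEfficient_topItemAlloc :
    SDPlusEfficient sharedRankingValue (fun _ => Equiv.refl _) topItemAlloc := by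
  rintro ⟨y, hy, hge, i, -, hne⟩
  refine hne (congrFun (hy.eq_topItemAlloc fun i l => hge i l ?_) i)
  rw [numPos_sharedRankingValue]
  exact l.isLt

lemma utility_lt_utility_not_topItemAlloc (i : Fin 2) :
    utility (sharedRankingValue i) (topItemAlloc i)
      < utility (sharedRankingValue i) fun j => !topItemAlloc i j := by
  fin_cases i <;>
    norm_num [utility, Fin.sum_univ_succ, sharedRankingValue, topItemAlloc]

/-- There exist agents, items, a nonnegative additive valuation profile, and an allocation
that is SD⁺efficient but not Pareto efficient. -/
theorem stmt4 :
    ∃ (n m : ℕ) (v : Fin n → Fin m → ℝ) (p : Fin n → (Fin m ≃ Fin m))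
      (x : Fin n → Fin m → Bool),
      (∀ i j, 0 ≤ v i j) ∧ (∀ i, IsRanking (v i) (p i)) ∧ IsAlloc x ∧
        SDPlusEfficient v p x ∧ ¬ ParetoEfficient v x := by
  refine ⟨2, 3, sharedRankingValue, fun _ => Equiv.refl _, topItemAlloc,
    fun i j => (sharedRankingValue_pos i j).le, isRanking_sharedRankingValue,
    isAlloc_topItemAlloc, sdPlusEfficient_topItemAlloc, not_not_intro ?_⟩
  exact ⟨_, isAlloc_not_topItemAlloc, fun i => (utility_lt_utility_not_topItemAlloc i).le,
    0, utility_lt_utility_not_topItemAlloc 0⟩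
end

section
/- For n = 2 agents with additive valuations, there exists a deterministic DSIC mechanism that always outputs SD efficient allocations and is not a serial dictatorship (i.e., neither agent is a dictator: for each agent i there is a reported profile on which some item positively valued by agent i is not allocated to agent i). -/
/-- `a ⪰_i b`: the prefix-sum inequality holds at every position `ℓ ∈ {1, …, m}`. -/
def SDGE {m : ℕ} (p : Fin m ≃ Fin m) (a b : Fin m → Bool) : Prop :=
  ∀ l : Fin m, prefixCount p b l ≤ prefixCount p a l

/-- Allocation `y` stochastically dominates allocation `x`: `y_i ⪰_i x_i` for every agent
`i`, and `y_j ≻_j x_j` (i.e. `y_j ⪰_j x_j` and `y_j ≠ x_j`) for some agent `j`. -/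
def SDDom {n m : ℕ} (p : Fin n → (Fin m ≃ Fin m)) (y x : Fin n → Fin m → Bool) : Prop :=
  (∀ i, SDGE (p i) (y i) (x i)) ∧ ∃ i, SDGE (p i) (y i) (x i) ∧ y i ≠ x i

/-- An allocation is SD efficient iff no allocation stochastically dominates it. -/
def SDEfficient {n m : ℕ} (p : Fin n → (Fin m ≃ Fin m)) (x : Fin n → Fin m → Bool) : Prop :=
  ¬ ∃ y, IsAlloc y ∧ SDDom p y x

/-- A nonnegative valuation. -/
def NonnegVal {m : ℕ} (v : Fin m → ℝ) : Prop := ∀ j, 0 ≤ v j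

/-- Every valuation of at least one item has a last-ranked item. -/
lemma exists_worst_item {m : ℕ} (hm : 0 < m) (v : Fin m → ℝ) :
    ∃ w : Fin m, ∀ j, v w < v j ∨ (v w = v j ∧ j ≤ w) := by
  have : Nonempty (Fin m) := ⟨⟨0, hm⟩⟩
  obtain ⟨w, -, hw⟩ := Finset.exists_min_image Finset.univ
    (fun j : Fin m => toLex (v j, OrderDual.toDual j)) Finset.univ_nonempty
  refine ⟨w, fun j => ?_⟩
  simpa [Prod.Lex.toLex_le_toLex] using hw j (Finset.mem_univ j)

lemma utility_ne_item {m : ℕ} (t : Fin m → ℝ) (w : Fin m) :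
    utility t (fun j => decide (j ≠ w)) = (∑ j, t j) - t w := by
  have h : ∀ j, (if decide (j ≠ w) = true then t j else 0) = t j - if j = w then t j else 0 := by
    intro j
    by_cases hj : j = w <;> simp [hj]
  rw [utility, Finset.sum_congr rfl fun j _ => h j, Finset.sum_sub_distrib]
  simp

lemma worst_lt_of_isRanking {m : ℕ} {v : Fin m → ℝ} {p : Fin m ≃ Fin m} {w : Fin m}
    (hp : IsRanking v p) (hw : ∀ j, v w < v j ∨ (v w = v j ∧ j ≤ w)) {j : Fin m} (hj : j ≠ w) :
    p.symm j < p.symm w := by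
  by_contra! h
  have hlt : p.symm w < p.symm j := lt_of_le_of_ne h fun h' => hj (p.symm.injective h').symm
  have h₁ := hp _ _ hlt
  simp only [Equiv.apply_symm_apply] at h₁
  rcases h₁ with h₁ | ⟨h₁, h₂⟩ <;> rcases hw j with h₃ | ⟨h₃, h₄⟩
  · linarith
  · linarith
  · linarith
  · exact absurd h₂ (not_lt.mpr h₄)

/-- A bundle stochastically dominating one that is full up to position `l` is full there too. -/
lemma SDGE.eq_true_of_prefix_full {m : ℕ} {p : Fin m ≃ Fin m} {a b : Fin m → Bool}
    (h : SDGE p a b) {l : Fin m} (hb : ∀ k ≤ l, b (p k) = true) : a (p l) = true := by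
  by_contra ha
  refine absurd (h l) (not_le.mpr (Finset.sum_lt_sum (fun k hk => ?_) ⟨l, by simp, ?_⟩))
  · rw [hb k (by simpa using hk)]
    split <;> simp
  · simp [ha, hb l le_rfl]

/-- A bundle stochastically dominating a nonempty bundle is nonempty. -/
lemma SDGE.exists_eq_true {m : ℕ} {p : Fin m ≃ Fin m} {a b : Fin m → Bool}
    (h : SDGE p a b) {w : Fin m} (hb : b w = true) : ∃ j, a j = true := by
  by_contra! ha
  have h₁ := h (p.symm w)
  have h₂ : prefixCount p a (p.symm w) = 0 := by simp [prefixCount, ha]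
  have h₃ : 0 < prefixCount p b (p.symm w) :=
    Finset.sum_pos' (fun _ _ => Nat.zero_le _) ⟨p.symm w, by simp, by simp [hb]⟩
  omega

/-- Agent `1` receives the item `w` and agent `0` receives everything else. -/
def giveAway {m : ℕ} (w : Fin m) : Fin 2 → Fin m → Bool :=
  ![fun j => decide (j ≠ w), fun j => decide (j = w)]

lemma isAlloc_giveAway {m : ℕ} (w : Fin m) : IsAlloc (giveAway w) := by
  intro j
  by_cases hj : j = w
  · exact ⟨1, by simp [giveAway, hj], fun i => by fin_cases i <;> simp [giveAway, hj]⟩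
  · exact ⟨0, by simp [giveAway, hj], fun i => by fin_cases i <;> simp [giveAway, hj]⟩

lemma sdEfficient_giveAway {m : ℕ} {v : Fin m → ℝ} {p : Fin 2 → (Fin m ≃ Fin m)} {w : Fin m}
    (hp : IsRanking v (p 0)) (hw : ∀ j, v w < v j ∨ (v w = v j ∧ j ≤ w)) :
    SDEfficient p (giveAway w) := by
  rintro ⟨y, hy, hdom, i, -, hne⟩
  have excl : ∀ j, ¬ (y 0 j = true ∧ y 1 j = true) := fun j ⟨h₀, h₁⟩ =>
    zero_ne_one ((hy j).unique h₀ h₁)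
  have h₀ : ∀ j, j ≠ w → y 0 j = true := by
    intro j hj
    have hlt := worst_lt_of_isRanking hp hw hj
    have := (hdom 0).eq_true_of_prefix_full (l := (p 0).symm j) fun k hk => by
      simp only [giveAway, Matrix.cons_val_zero, decide_eq_true_eq]
      rintro rfl
      exact absurd (hk.trans_lt hlt) (by simp)
    simpa using this
  obtain ⟨j, hj⟩ := (hdom 1).exists_eq_true (w := w) (by simp [giveAway])
  obtain rfl : j = w := by
    by_contra hjw
    exact excl j ⟨h₀ j hjw, hj⟩
  apply hne
  ext k
  by_cases hk : k = j
  · subst hk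
    have := excl k
    fin_cases i <;> simp_all [giveAway]
  · have := excl k
    have := h₀ k hk
    fin_cases i <;> simp_all [giveAway]

/-- For `n = 2` agents and `m ≥ 2` items there is a deterministic DSIC mechanism that
always outputs SD efficient allocations and is not a serial dictatorship: for each agent
`i` there is a reported profile on which some item positively valued by `i` is not
allocated to `i`. -/
theorem stmt7 (m : ℕ) (hm : 2 ≤ m) :
    ∃ M : (Fin 2 → Fin m → ℝ) → (Fin 2 → Fin m → Bool),
      (∀ b, (∀ i, NonnegVal (b i)) → IsAlloc (M b)) ∧
      (∀ (i : Fin 2) (t r : Fin m → ℝ) (b : Fin 2 → Fin m → ℝ),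
        NonnegVal t → NonnegVal r → (∀ i', NonnegVal (b i')) →
        utility t (M (Function.update b i r) i) ≤ utility t (M (Function.update b i t) i)) ∧
      (∀ b, (∀ i, NonnegVal (b i)) →
        ∀ p : Fin 2 → (Fin m ≃ Fin m), (∀ i, IsRanking (b i) (p i)) →
          SDEfficient p (M b)) ∧
      (∀ i : Fin 2, ∃ b, (∀ i', NonnegVal (b i')) ∧ ∃ j, 0 < b i j ∧ M b i j = false) := by
  choose w hw using exists_worst_item (m := m) (by omega)
  refine ⟨fun b => giveAway (w (b 0)), fun b _ => isAlloc_giveAway _, ?_, ?_, ?_⟩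
  · intro i t r b _ _ _
    fin_cases i
    · have h : t (w t) ≤ t (w r) := (hw t (w r)).elim le_of_lt fun h => h.1.le
      change utility t (fun j => decide (j ≠ w r)) ≤ utility t (fun j => decide (j ≠ w t))
      rw [utility_ne_item, utility_ne_item]
      linarith
    · simp
  · exact fun b _ p hp => sdEfficient_giveAway (hp 0) (hw (b 0))
  · have := Fin.nontrivial_iff_two_le.mpr hm
    obtain ⟨j, hj⟩ := exists_ne (w fun _ => 1)
    intro i
    refine ⟨fun _ _ => 1, fun _ _ => zero_le_one, ?_⟩
    fin_cases i
    · exact ⟨w fun _ => 1, one_pos, by simp [giveAway]⟩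
    · exact ⟨j, one_pos, by simp [giveAway, hj]⟩
end

section
/- Fix reals y > x > 0. For agents with bivalued additive preferences, where every value v_{i,j} lies in {x, y}, there exists a deterministic DSIC mechanism that always outputs Pareto efficient allocations and is not a serial dictatorship (no agent receives, on every input, all of the items). -/
/-- A valuation over the bivalued domain `{x, y}`. -/
def Bivalued {m : ℕ} (x y : ℝ) (v : Fin m → ℝ) : Prop :=
  ∀ j, v j = x ∨ v j = y

/-- A most valuable item for `w` which, among those, is least valuable for `v`. -/
lemma exists_lex_best {m : ℕ} (hm : 0 < m) (v w : Fin m → ℝ) :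
    ∃ j, (∀ l, w l ≤ w j) ∧ ∀ l, w l = w j → v j ≤ v l := by
  have : Nonempty (Fin m) := ⟨⟨0, hm⟩⟩
  obtain ⟨k, hk⟩ := Finite.exists_max w
  obtain ⟨j, hj, hmin⟩ := (Finset.univ.filter fun l => w l = w k).exists_min_image v ⟨k, by simp⟩
  simp only [Finset.mem_filter, Finset.mem_univ, true_and] at hj hmin
  exact ⟨j, fun l => hj ▸ hk l, fun l hl => hmin l (hl.trans hj)⟩

/-- The allocation giving item `j` to agent `1` and all other items to agent `0`. -/
def singleOut {m : ℕ} (j : Fin m) : Fin 2 → Fin m → Bool :=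
  fun i l => if i = 0 then decide (l ≠ j) else decide (l = j)

lemma isAlloc_singleOut {m : ℕ} (j : Fin m) : IsAlloc (singleOut j) := by
  intro l
  by_cases h : l = j
  · exact ⟨1, by simp [singleOut, h], fun i => by fin_cases i <;> simp [singleOut, h]⟩
  · exact ⟨0, by simp [singleOut, h], fun i => by fin_cases i <;> simp [singleOut, h]⟩

lemma utility_singleOut_one {m : ℕ} (v : Fin m → ℝ) (j : Fin m) :
    utility v (singleOut j 1) = v j := by
  simp [utility, singleOut]

lemma utility_singleOut_zero {m : ℕ} (v : Fin m → ℝ) (j : Fin m) :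
    utility v (singleOut j 0) = (∑ l, v l) - v j := by
  rw [eq_sub_iff_add_eq, ← utility_singleOut_one v j, utility, utility, ← Finset.sum_add_distrib]
  refine Finset.sum_congr rfl fun l _ => ?_
  by_cases h : l = j <;> simp [singleOut, h]

/-- Giving agent `1` a single item that minimises the ratio of agent `0`'s value to agent `1`'s
value is Pareto efficient. -/
lemma paretoEfficient_singleOut {m : ℕ} (v : Fin 2 → Fin m → ℝ) (j : Fin m)
    (h0 : 0 < v 0 j) (h1 : 0 < v 1 j) (h : ∀ l, v 0 j * v 1 l ≤ v 0 l * v 1 j) :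
    ParetoEfficient v (singleOut j) := by
  rintro ⟨z, hz, hle, i, hi⟩
  have key : v 1 j * utility (v 0) (z 0) + v 0 j * utility (v 1) (z 1) ≤
      v 1 j * utility (v 0) (singleOut j 0) + v 0 j * utility (v 1) (singleOut j 1) := by
    simp only [utility, Finset.mul_sum, ← Finset.sum_add_distrib]
    refine Finset.sum_le_sum fun l _ => ?_
    have hzl : z 1 l = !z 0 l := by
      obtain ⟨a, ha, hu⟩ := hz l
      cases h0 : z 0 l <;> cases h1 : z 1 l
      · fin_cases a
        · exact absurd (h0.symm.trans ha) Bool.false_ne_true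
        · exact absurd (h1.symm.trans ha) Bool.false_ne_true
      · rfl
      · rfl
      · exact absurd ((hu 0 h0).trans (hu 1 h1).symm) zero_ne_one
    have hl := h l
    rw [hzl]
    rcases eq_or_ne l j with rfl | hlj <;> cases z 0 l
    · simp [singleOut]
    · simp [singleOut, mul_comm]
    · simpa [singleOut, hlj, mul_comm] using hl
    · simp [singleOut, hlj]
  have g0 := hle 0
  have g1 := hle 1
  fin_cases i
  · have := mul_lt_mul_of_pos_left hi h1
    have := mul_le_mul_of_nonneg_left g1 h0.le
    simp only [Fin.zero_eta] at *
    linarith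
  · have := mul_lt_mul_of_pos_left hi h0
    have := mul_le_mul_of_nonneg_left g0 h1.le
    simp only [Fin.mk_one] at *
    linarith

/-- Fix reals `y > x > 0`.  For `n = 2` agents with bivalued additive preferences (every
value in `{x, y}`) over `m ≥ 2` items, there is a deterministic DSIC mechanism that
always outputs Pareto efficient allocations and is not a serial dictatorship: no agent
receives, on every input, all of the items. -/
theorem stmt8 (x y : ℝ) (hx : 0 < x) (hxy : x < y) (m : ℕ) (hm : 2 ≤ m) :
    ∃ M : (Fin 2 → Fin m → ℝ) → (Fin 2 → Fin m → Bool),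
      (∀ b, (∀ i, Bivalued x y (b i)) → IsAlloc (M b)) ∧
      (∀ (i : Fin 2) (t r : Fin m → ℝ) (b : Fin 2 → Fin m → ℝ),
        Bivalued x y t → Bivalued x y r → (∀ i', Bivalued x y (b i')) →
        utility t (M (Function.update b i r) i) ≤ utility t (M (Function.update b i t) i)) ∧
      (∀ b, (∀ i, Bivalued x y (b i)) → ParetoEfficient b (M b)) ∧
      (∀ i : Fin 2, ∃ b, (∀ i', Bivalued x y (b i')) ∧ ∃ j, M b i j = false) := by
  choose f hmax hmin using fun b : Fin 2 → Fin m → ℝ =>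
    exists_lex_best (by omega : 0 < m) (b 0) (b 1)
  refine ⟨fun b => singleOut (f b), fun b _ => isAlloc_singleOut _, ?_, ?_, ?_⟩
  · intro i t r b _ _ _
    fin_cases i
    · simp only [Fin.zero_eta, utility_singleOut_zero]
      set bt := Function.update b 0 t with hbt
      set br := Function.update b 0 r with hbr
      have ht1 : bt 1 = b 1 := by simp [hbt]
      have hr1 : br 1 = b 1 := by simp [hbr]
      have ht0 : bt 0 = t := by simp [hbt]
      have hrt := hmax br (f bt)
      have htr := hmax bt (f br)
      have hle := hmin bt (f br)
      rw [hr1] at hrt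
      rw [ht1] at htr hle
      rw [ht0] at hle
      linarith [hle (le_antisymm htr hrt)]
    · simp only [Fin.mk_one, utility_singleOut_one]
      simpa using hmax (Function.update b 1 t) (f (Function.update b 1 r))
  · intro b hb
    have bounds : ∀ i l, x ≤ b i l ∧ b i l ≤ y := by
      intro i l
      rcases hb i l with h | h <;> rw [h] <;> constructor <;> linarith
    refine paretoEfficient_singleOut b (f b) (hx.trans_le (bounds 0 _).1)
      (hx.trans_le (bounds 1 _).1) fun l => ?_
    rcases (hmax b l).eq_or_lt with h | h
    · rw [h]
      exact mul_le_mul_of_nonneg_right (hmin b l h) (hx.trans_le (bounds 1 _).1).le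
    · have hlx : b 1 l = x := (hb 1 l).resolve_right fun e => by
        linarith [(bounds 1 (f b)).2]
      have hjy : b 1 (f b) = y := (hb 1 (f b)).resolve_left fun e => by linarith
      rw [hlx, hjy, mul_comm (b 0 l)]
      nlinarith [(bounds 0 (f b)).2, (bounds 0 l).1]
  · intro i
    refine ⟨fun _ _ => x, fun _ _ => Or.inl rfl, ?_⟩
    fin_cases i
    · exact ⟨f fun _ _ => x, by simp [singleOut]⟩
    · have : Nontrivial (Fin m) := Fin.nontrivial_iff_two_le.mpr hm
      obtain ⟨l, hl⟩ := exists_ne (f fun _ _ => x)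
      exact ⟨l, by simp [singleOut, hl]⟩
end

section
/- Fix n agents and m items and the Round-Robin-with-pass allocation rule RR^pass. For each agent i, there exists a positional interim allocation vector q^pos_i = (q^pos_{i,1}, …, q^pos_{i,m}) such that for every reported tuple (p_i, m_i) (a strict preference order p_i over items together with a number m_i ≤ m of positively valued items) and every item j: if j = p_i(k) for some k ≤ m_i, then the interim allocation q_{i,j}(p_i, m_i) := (1/(m!)^{n-1}) · Σ over all (n-1)-tuples p_{-i} of strict preference orders of the other agents of the indicator that RR^pass on input ((p_i, m_i), (p_{-i}, m)) allocates item j to agent i, equals q^pos_{i,k}; and if j = p_i(k) for some k > m_i, then q_{i,j}(p_i, m_i) = 0. -/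
/-- One turn of `RR^pass`: agent `i` picks her highest-ranked (smallest position `k`,
among her top `mr i` positions) still-unallocated item; if none remains she passes. -/
def rrTurn {n m : ℕ} (pr : Fin n → (Fin m ≃ Fin m)) (mr : Fin n → ℕ)
    (st : Fin m → Option (Fin n)) (i : Fin n) : Fin m → Option (Fin n) :=
  match (List.finRange m).find?
      (fun k => decide (k.val < mr i) && decide (st (pr i k) = none)) with
  | none => st
  | some k => Function.update st (pr i k) (some i)

/-- The assignment produced by the round-robin phase of `RR^pass`: agents take turns in
the fixed order `1, 2, …, n`, over `m` rounds (enough rounds for every item positively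
valued by some agent to be allocated). -/
def rrAssign {n m : ℕ} (pr : Fin n → (Fin m ≃ Fin m)) (mr : Fin n → ℕ) :
    Fin m → Option (Fin n) :=
  (List.range m).foldl (fun st _ => (List.finRange n).foldl (rrTurn pr mr) st)
    (fun _ => none)

/-- The `RR^pass` allocation: items left over by the round-robin phase (valued zero by
everybody) are completed in a fixed arbitrary deterministic manner (here: to agent `0`). -/
def rrAlloc {n m : ℕ} (pr : Fin n → (Fin m ≃ Fin m)) (mr : Fin n → ℕ)
    (i : Fin n) (j : Fin m) : Bool :=
  decide (rrAssign pr mr j = some i ∨ (rrAssign pr mr j = none ∧ (i : ℕ) = 0))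

/-- The interim allocation `q_{i,j}(p, mi)`: the average, over all `(n-1)`-tuples of
strict preference orders of the other agents (each reporting all `m` items as positively
valued), of the indicator that `RR^pass` allocates item `j` to agent `i` when she reports
the tuple `(p, mi)`; normalized by `(m!)^(n-1)`. -/
noncomputable def interim {n m : ℕ} (i : Fin n) (p : Fin m ≃ Fin m) (mi : ℕ)
    (j : Fin m) : ℝ :=
  (1 / ((Nat.factorial m : ℝ) ^ (n - 1))) *
    ∑ po : {i' : Fin n // i' ≠ i} → (Fin m ≃ Fin m),
      if rrAlloc (fun i' => if h : i' = i then p else po ⟨i', h⟩)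
          (fun i' => if i' = i then mi else m) i j then (1 : ℝ) else 0

/-- A turn either finds all positively valued items allocated and changes nothing, or allocates
the first free positively valued item. -/
theorem rrTurn_spec {n m : ℕ} (pr : Fin n → (Fin m ≃ Fin m)) (mr : Fin n → ℕ)
    (st : Fin m → Option (Fin n)) (i : Fin n) :
    ((∀ k : Fin m, (k : ℕ) < mr i → st (pr i k) ≠ none) ∧ rrTurn pr mr st i = st) ∨
      ∃ k : Fin m, (k : ℕ) < mr i ∧ st (pr i k) = none ∧
        (∀ k' < k, st (pr i k') ≠ none) ∧
        rrTurn pr mr st i = Function.update st (pr i k) (some i) := by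
  unfold rrTurn
  split
  · next h =>
    left
    simpa using h
  · next k h =>
    right
    rw [List.find?_eq_some_iff_getElem] at h
    obtain ⟨h₁, a, ha, rfl, h₂⟩ := h
    simp only [Bool.and_eq_true, decide_eq_true_eq] at h₁
    refine ⟨_, h₁.1, h₁.2, fun k' hk' hn => ?_, rfl⟩
    have hlt : (k' : ℕ) < a := by simpa [Fin.lt_def] using hk'
    have := h₂ k' hlt
    have hmr : (k' : ℕ) < mr i := lt_trans hlt (by simpa using h₁.1)
    simp [hmr, hn] at this

theorem rrTurn_apply_of_ne_none {n m : ℕ} (pr : Fin n → (Fin m ≃ Fin m)) (mr : Fin n → ℕ)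
    {st : Fin m → Option (Fin n)} (i : Fin n) {j : Fin m} (hj : st j ≠ none) :
    rrTurn pr mr st i j = st j := by
  rcases rrTurn_spec pr mr st i with ⟨-, h⟩ | ⟨k, -, hk, -, h⟩
  · rw [h]
  · rw [h, Function.update_of_ne]
    rintro rfl
    exact hj hk

theorem rrTurn_comp {n m : ℕ} (pr : Fin n → (Fin m ≃ Fin m)) (mr : Fin n → ℕ)
    (σ : Fin m ≃ Fin m) (st : Fin m → Option (Fin n)) (i : Fin n) :
    rrTurn (fun i' => (pr i').trans σ) mr st i ∘ σ = rrTurn pr mr (st ∘ σ) i := by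
  unfold rrTurn
  simp only [Equiv.trans_apply, Function.comp_apply]
  split
  · next h => erw [h]
  · next h =>
    erw [h]
    exact Function.update_comp_eq_of_injective _ σ.injective _ _

/-- Two runs of the round-robin phase preserve every relation preserved by their turns. -/
theorem rrAssign_rel {n m : ℕ} {pr pr' : Fin n → (Fin m ≃ Fin m)} {mr mr' : Fin n → ℕ}
    (R : (Fin m → Option (Fin n)) → (Fin m → Option (Fin n)) → Prop)
    (h₀ : R (fun _ => none) (fun _ => none))
    (h : ∀ i st st', R st st' → R (rrTurn pr mr st i) (rrTurn pr' mr' st' i)) :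
    R (rrAssign pr mr) (rrAssign pr' mr') :=
  List.foldl_rel h₀ fun _ _ _ _ hR => List.foldl_rel hR fun i _ st st' => h i st st'

/-- The round-robin phase is neutral: relabelling the items relabels the outcome. -/
theorem rrAssign_trans_apply {n m : ℕ} (pr : Fin n → (Fin m ≃ Fin m)) (mr : Fin n → ℕ)
    (σ : Fin m ≃ Fin m) (j : Fin m) :
    rrAssign (fun i => (pr i).trans σ) mr (σ j) = rrAssign pr mr j := by
  refine congrFun (rrAssign_rel (fun st st' => st ∘ σ = st') rfl ?_) j
  rintro i st _ rfl
  exact rrTurn_comp pr mr σ st i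

/-- Extending the list of positively valued items of one agent does not affect who obtains
the items she valued positively before. -/
theorem rrAssign_apply_of_le {n m : ℕ} (pr : Fin n → (Fin m ≃ Fin m)) {mr mr' : Fin n → ℕ}
    (i : Fin n) (hne : ∀ i' ≠ i, mr i' = mr' i') (hle : mr i ≤ mr' i)
    {k : Fin m} (hk : (k : ℕ) < mr i) :
    rrAssign pr mr (pr i k) = rrAssign pr mr' (pr i k) := by
  have key := rrAssign_rel (pr := pr) (pr' := pr) (mr := mr) (mr' := mr')
    (fun st st' => st = st' ∨ ∀ k : Fin m, (k : ℕ) < mr i →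
      st (pr i k) = st' (pr i k) ∧ st (pr i k) ≠ none) (Or.inl rfl) ?_
  · rcases key with h | h
    · rw [h]
    · exact (h k hk).1
  rintro i' st st' (rfl | h)
  · rcases eq_or_ne i' i with rfl | hi
    · rcases rrTurn_spec pr mr st i' with ⟨h, -⟩ | ⟨a, ha, han, hamin, h⟩
      · right
        intro k hk
        rw [rrTurn_apply_of_ne_none pr mr i' (h k hk), rrTurn_apply_of_ne_none pr mr' i' (h k hk)]
        exact ⟨rfl, h k hk⟩
      · left
        rcases rrTurn_spec pr mr' st i' with ⟨h', -⟩ | ⟨b, -, hbn, hbmin, h'⟩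
        · exact absurd han (h' a (ha.trans_le hle))
        · have : a = b := le_antisymm (not_lt.1 fun hlt => hamin b hlt hbn)
            (not_lt.1 fun hlt => hbmin a hlt han)
          rw [h, h', this]
    · left
      simp only [rrTurn, hne i' hi]
  · right
    intro k hk
    obtain ⟨h₁, h₂⟩ := h k hk
    rw [rrTurn_apply_of_ne_none pr mr i' h₂, rrTurn_apply_of_ne_none pr mr' i' (h₁ ▸ h₂)]
    exact ⟨h₁, h₂⟩

/-- The round-robin phase gives no agent an item outside her positively valued ones. -/
theorem rrAssign_apply_ne_some {n m : ℕ} (pr : Fin n → (Fin m ≃ Fin m)) (mr : Fin n → ℕ)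
    (i : Fin n) {k : Fin m} (hk : mr i ≤ k) : rrAssign pr mr (pr i k) ≠ some i := by
  refine rrAssign_rel (pr' := pr) (mr' := mr) (fun st _ => st (pr i k) ≠ some i) (by simp) ?_
  intro i' st _ hst
  rcases rrTurn_spec pr mr st i' with ⟨-, h⟩ | ⟨a, ha, -, -, h⟩
  · rwa [h]
  · rw [h]
    by_cases hka : pr i k = pr i' a
    · rw [hka, Function.update_self]
      rintro h
      obtain rfl := Option.some_injective _ h
      obtain rfl := (pr i').injective hka
      omega
    · rwa [Function.update_of_ne hka]

/-- The number of unallocated items. -/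
def rrFree {n m : ℕ} (st : Fin m → Option (Fin n)) : ℕ :=
  (Finset.univ.filter fun j => st j = none).card

theorem rrFree_rrTurn_le {n m : ℕ} (pr : Fin n → (Fin m ≃ Fin m)) (mr : Fin n → ℕ)
    (st : Fin m → Option (Fin n)) (i : Fin n) : rrFree (rrTurn pr mr st i) ≤ rrFree st := by
  refine Finset.card_le_card fun j hj => ?_
  simp only [Finset.mem_filter, Finset.mem_univ, true_and] at hj ⊢
  by_contra h
  exact h (rrTurn_apply_of_ne_none pr mr i h ▸ hj)

theorem rrFree_rrTurn_le_sub_one {n m : ℕ} (pr : Fin n → (Fin m ≃ Fin m)) (mr : Fin n → ℕ)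
    (st : Fin m → Option (Fin n)) {i : Fin n} (hi : mr i = m) :
    rrFree (rrTurn pr mr st i) ≤ rrFree st - 1 := by
  rcases rrTurn_spec pr mr st i with ⟨h, h'⟩ | ⟨k, -, hk, -, h⟩
  · have : rrFree st = 0 := by
      refine Finset.card_eq_zero.2 (Finset.filter_eq_empty_iff.2 fun j _ => ?_)
      simpa using h ((pr i).symm j) (by rw [hi]; exact Fin.is_lt _)
    rw [h', this]
  · refine Nat.le_sub_one_of_lt (Finset.card_lt_card (Finset.ssubset_iff_of_subset ?_ |>.2 ?_))
    · intro j hj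
      simp only [Finset.mem_filter, Finset.mem_univ, true_and] at hj ⊢
      by_contra hn
      exact hn (rrTurn_apply_of_ne_none pr mr i hn ▸ hj)
    · exact ⟨pr i k, by simpa using hk, by simp [h]⟩

theorem rrFree_foldl_le {n m : ℕ} (pr : Fin n → (Fin m ≃ Fin m)) (mr : Fin n → ℕ)
    (l : List (Fin n)) (st : Fin m → Option (Fin n)) :
    rrFree (l.foldl (rrTurn pr mr) st) ≤ rrFree st := by
  induction l generalizing st with
  | nil => exact le_rfl
  | cons a l ih => exact (ih _).trans (rrFree_rrTurn_le pr mr st a)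

theorem rrFree_foldl_le_sub_one {n m : ℕ} (pr : Fin n → (Fin m ≃ Fin m)) (mr : Fin n → ℕ)
    {l : List (Fin n)} {i : Fin n} (hil : i ∈ l) (hi : mr i = m)
    (st : Fin m → Option (Fin n)) :
    rrFree (l.foldl (rrTurn pr mr) st) ≤ rrFree st - 1 := by
  obtain ⟨s, t, rfl⟩ := List.append_of_mem hil
  rw [List.foldl_append, List.foldl_cons]
  exact (rrFree_foldl_le pr mr t _).trans <| (rrFree_rrTurn_le_sub_one pr mr _ hi).trans <|
    Nat.sub_le_sub_right (rrFree_foldl_le pr mr s st) 1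

/-- If some agent values all items positively, the round-robin phase allocates every item. -/
theorem rrAssign_apply_ne_none {n m : ℕ} (pr : Fin n → (Fin m ≃ Fin m)) (mr : Fin n → ℕ)
    {i : Fin n} (hi : mr i = m) (j : Fin m) : rrAssign pr mr j ≠ none := by
  have rounds : ∀ r : ℕ, rrFree ((List.range r).foldl
      (fun st _ => (List.finRange n).foldl (rrTurn pr mr) st) fun _ : Fin m => none) ≤ m - r := by
    intro r
    induction r with
    | zero => exact (Finset.card_le_univ _).trans (by simp)
    | succ r ih =>
      rw [List.range_succ, List.foldl_append, List.foldl_cons, List.foldl_nil]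
      have := rrFree_foldl_le_sub_one pr mr (List.mem_finRange i) hi ((List.range r).foldl
        (fun st _ => (List.finRange n).foldl (rrTurn pr mr) st) fun _ : Fin m => none)
      omega
  have hfree : rrFree (rrAssign pr mr) = 0 := by
    have := rounds m
    rwa [Nat.sub_self, Nat.le_zero] at this
  exact Finset.filter_eq_empty_iff.1 (Finset.card_eq_zero.1 hfree) (Finset.mem_univ j)

theorem interim_apply_of_lt {n m : ℕ} (i : Fin n) (p : Fin m ≃ Fin m) {mi : ℕ} (hmi : mi ≤ m)
    {k : Fin m} (hk : (k : ℕ) < mi) :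
    interim i p mi (p k) = interim i (Equiv.refl _) m k := by
  unfold interim
  congr 1
  refine (Fintype.sum_equiv (Equiv.piCongrRight fun _ => Equiv.equivCongr (Equiv.refl _) p)
    _ _ fun po => ?_).symm
  have hpr : (fun i' => if h : i' = i then p else (po ⟨i', h⟩).trans p) =
      fun i' => (if h : i' = i then Equiv.refl _ else po ⟨i', h⟩).trans p := by
    funext i'
    split <;> rfl
  have hle := rrAssign_apply_of_le
    (fun i' => if h : i' = i then p else (po ⟨i', h⟩).trans p)
    (mr := fun i' => if i' = i then mi else m) (mr' := fun i' => if i' = i then m else m) i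
    (fun i' hi' => by simp [hi']) (by simpa using hmi) (k := k) (by simpa using hk)
  simp only [dite_true] at hle
  have htrans := rrAssign_trans_apply (fun i' => if h : i' = i then Equiv.refl _ else po ⟨i', h⟩)
    (fun i' => if i' = i then m else m) p k
  rw [← hpr] at htrans
  have hpo : ∀ i', (Equiv.piCongrRight (fun _ : {i' : Fin n // i' ≠ i} =>
      Equiv.equivCongr (Equiv.refl (Fin m)) p)) po i' = (po i').trans p := fun _ => rfl
  simp only [rrAlloc, hpo, hle, htrans]
  congr

theorem interim_apply_of_le {n m : ℕ} (hn : 2 ≤ n) (i : Fin n) (p : Fin m ≃ Fin m) {mi : ℕ}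
    {k : Fin m} (hk : mi ≤ (k : ℕ)) : interim i p mi (p k) = 0 := by
  have : Nontrivial (Fin n) := Fin.nontrivial_iff_two_le.2 hn
  obtain ⟨i', hi'⟩ := exists_ne i
  unfold interim
  refine mul_eq_zero_of_right _ (Finset.sum_eq_zero fun po _ => if_neg ?_)
  have hnone := rrAssign_apply_ne_none (fun i' => if h : i' = i then p else po ⟨i', h⟩)
    (fun i' => if i' = i then mi else m) (i := i') (if_neg hi') (p k)
  have hsome := rrAssign_apply_ne_some (fun i' => if h : i' = i then p else po ⟨i', h⟩)
    (fun i' => if i' = i then mi else m) i (k := k) (by simpa using hk)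
  simp only [dite_true] at hsome
  simp [rrAlloc, hnone, hsome]

/-- Positional structure of the interim allocations of `RR^pass` (for `n ≥ 2` agents):
for each agent `i` there is a positional interim allocation vector `q^pos_i` such that,
whenever `i` reports a tuple `(p, mi)`, the interim allocation of the item ranked `k`-th
equals `q^pos_{i,k}` if `k ≤ mi` (the item is positively valued), and equals `0` if
`k > mi` (the item is reported as zero-valued). -/
theorem stmt11 (n m : ℕ) (hn : 2 ≤ n) (i : Fin n) :
    ∃ qpos : Fin m → ℝ,
      ∀ (p : Fin m ≃ Fin m) (mi : ℕ), mi ≤ m →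
        ∀ k : Fin m,
          ((k : ℕ) < mi → interim i p mi (p k) = qpos k) ∧
          (mi ≤ (k : ℕ) → interim i p mi (p k) = 0) := by
  exact ⟨interim i (Equiv.refl _) m, fun p _ hmi _ =>
    ⟨interim_apply_of_lt i p hmi, interim_apply_of_le hn i p⟩⟩
end

section
/- Fix n agents and m items and the Round-Robin-with-pass allocation rule RR^pass. For each agent i, the positional interim allocation vector q^pos_i = (q^pos_{i,1}, …, q^pos_{i,m}) is monotone non-increasing: q^pos_{i,1} ≥ q^pos_{i,2} ≥ … ≥ q^pos_{i,m}, where q^pos_{i,k} is the interim probability (uniformly over all (n-1)-tuples of strict preference orders of the other agents, each reporting m positively valued items) that RR^pass allocates to agent i the item she ranks k-th when she reports a preference order with all m items positively valued. -/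
theorem rrTurn_of_eq_some {n m : ℕ} (pr : Fin n → (Fin m ≃ Fin m)) (mr : Fin n → ℕ)
    (st : Fin m → Option (Fin n)) (t : Fin n) {x : Fin m} {j : Fin n} (h : st x = some j) :
    rrTurn pr mr st t x = some j := by
  suffices H : ∀ s, s = rrTurn pr mr st t → s x = some j from H _ rfl
  intro s hs
  unfold rrTurn at hs
  split at hs
  · rw [hs, h]
  · next y hy =>
    have hy' := List.find?_some hy
    simp only [Bool.and_eq_true, decide_eq_true_eq] at hy'
    rw [hs, Function.update_of_ne, h]
    rintro rfl
    simp [hy'.2] at h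

/-- A turn of an agent whose preferences are relabelled by `σ` commutes with the relabelling. -/
theorem rrTurn_relabel {n m : ℕ} {pr pr' : Fin n → (Fin m ≃ Fin m)} (mr : Fin n → ℕ)
    (st : Fin m → Option (Fin n)) (t : Fin n) (σ : Fin m ≃ Fin m)
    (h : pr' t = (pr t).trans σ) :
    rrTurn pr' mr (st ∘ σ.symm) t = rrTurn pr mr st t ∘ σ.symm := by
  unfold rrTurn
  simp only [h, Equiv.trans_apply, Function.comp_apply, Equiv.symm_apply_apply]
  split
  · rfl
  · exact (Function.update_comp_equiv st σ.symm _ _).symm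

/-- An agent takes the item in position `y` when it is available and no better-ranked item is. -/
theorem rrTurn_eq_update {n m : ℕ} (pr : Fin n → (Fin m ≃ Fin m)) (mr : Fin n → ℕ)
    (st : Fin m → Option (Fin n)) (t : Fin n) {y : Fin m} (hy : (y : ℕ) < mr t)
    (hn : st (pr t y) = none) (hlt : ∀ x < y, st (pr t x) ≠ none) :
    rrTurn pr mr st t = Function.update st (pr t y) (some t) := by
  have hf : (List.finRange m).find?
      (fun k => decide (k.val < mr t) && decide (st (pr t k) = none)) = some y := by
    rw [List.find?_eq_some_iff_getElem]
    refine ⟨by simp [hy, hn], y, by simp, by simp, fun x hx => ?_⟩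
    have := hlt ⟨x, hx.trans y.2⟩ hx
    simp [this]
  unfold rrTurn
  rw [hf]

/-- The coupling between a run and the run in which the agents other than `i` have `a` and `b`
exchanged: the states correspond until agent `i` has received `a` in the second run, or
`b` has gone to another agent in the first. -/
def SwapCoupled {n m : ℕ} (i : Fin n) (a b : Fin m) (st st' : Fin m → Option (Fin n)) : Prop :=
  st' = st ∘ Equiv.swap a b ∨ st' a = some i ∨ ∃ j ≠ i, st b = some j

theorem SwapCoupled.turn {n m : ℕ} {pr pr' : Fin n → (Fin m ≃ Fin m)} {mr : Fin n → ℕ}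
    {i : Fin n} {k l : Fin m} (hkl : k ≤ l) (hk : (k : ℕ) < mr i) (hi : pr' i = pr i)
    (ho : ∀ t ≠ i, pr' t = (pr t).trans (Equiv.swap (pr i k) (pr i l)))
    {st st' : Fin m → Option (Fin n)} (h : SwapCoupled i (pr i k) (pr i l) st st')
    (t : Fin n) :
    SwapCoupled i (pr i k) (pr i l) (rrTurn pr mr st t) (rrTurn pr' mr st' t) := by
  rcases h with rfl | h | ⟨j, hj, h⟩
  · by_cases ht : t = i
    · subst t
      rcases hb : st (pr i l) with _ | j
      · have hex : ∃ y : Fin m, (st ∘ Equiv.swap (pr i k) (pr i l)) (pr' i y) = none :=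
          ⟨k, by simp [hi, hb]⟩
        obtain ⟨y, hy, hmin⟩ := wellFounded_lt.has_min
          {y : Fin m | (st ∘ Equiv.swap (pr i k) (pr i l)) (pr' i y) = none} hex
        have hyk : y ≤ k := not_lt.1 (hmin k (by simp [hi, hb]))
        rw [rrTurn_eq_update pr' mr _ i (lt_of_le_of_lt hyk hk) hy fun x hx hn => hmin x hn hx]
        rcases hyk.eq_or_lt with rfl | hyk
        · exact Or.inr (Or.inl (by simp [hi]))
        · left
          have hfix : ∀ x < k, Equiv.swap (pr i k) (pr i l) (pr i x) = pr i x := fun x hx =>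
            Equiv.swap_apply_of_ne_of_ne ((pr i).injective.ne hx.ne)
              ((pr i).injective.ne (hx.trans_le hkl).ne)
          rw [rrTurn_eq_update pr mr st i (y := y) (lt_trans hyk hk)
            (by simpa [hi, hfix y hyk] using hy)
            fun x hx hn => hmin x (by simpa [hi, hfix x (hx.trans hyk)] using hn) hx]
          rw [Function.update_comp_equiv, Equiv.symm_swap, hfix y hyk, hi]
      · by_cases hj : j = i
        · subst j
          exact Or.inr (Or.inl (rrTurn_of_eq_some _ _ _ _ (by simp [hb])))
        · exact Or.inr (Or.inr ⟨j, hj, rrTurn_of_eq_some _ _ _ _ hb⟩)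
    · left
      simpa only [Equiv.symm_swap] using rrTurn_relabel mr st t _ (ho t ht)
  · exact Or.inr (Or.inl (rrTurn_of_eq_some _ _ _ _ h))
  · exact Or.inr (Or.inr ⟨j, hj, rrTurn_of_eq_some _ _ _ _ h⟩)

theorem swapCoupled_rrAssign {n m : ℕ} {pr pr' : Fin n → (Fin m ≃ Fin m)} {mr : Fin n → ℕ}
    {i : Fin n} {k l : Fin m} (hkl : k ≤ l) (hk : (k : ℕ) < mr i) (hi : pr' i = pr i)
    (ho : ∀ t ≠ i, pr' t = (pr t).trans (Equiv.swap (pr i k) (pr i l))) :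
    SwapCoupled i (pr i k) (pr i l) (rrAssign pr mr) (rrAssign pr' mr) := by
  unfold rrAssign
  refine List.foldl_rel (Or.inl rfl) fun _ _ _ _ h => ?_
  exact List.foldl_rel h fun t _ _ _ h => h.turn hkl hk hi ho t

/-- If agent `i` receives her `l`-th item, then she receives her better-ranked `k`-th item once
the other agents exchange the two items in their preferences. -/
theorem rrAlloc_swap {n m : ℕ} {pr pr' : Fin n → (Fin m ≃ Fin m)} {mr : Fin n → ℕ}
    {i : Fin n} {k l : Fin m} (hkl : k ≤ l) (hk : (k : ℕ) < mr i) (hi : pr' i = pr i)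
    (ho : ∀ t ≠ i, pr' t = (pr t).trans (Equiv.swap (pr i k) (pr i l)))
    (h : rrAlloc pr mr i (pr i l)) : rrAlloc pr' mr i (pr i k) := by
  simp only [rrAlloc, decide_eq_true_eq] at h ⊢
  rcases swapCoupled_rrAssign hkl hk hi ho with heq | heq | ⟨j, hj, heq⟩
  · simpa [heq] using h
  · exact Or.inl heq
  · simp [heq, hj] at h

/-- Monotonicity of the positional interim allocations of `RR^pass`: when agent `i`
reports all `m` items as positively valued with preference order `p`, the interim
probability of receiving her `k`-th ranked item is non-increasing in `k`, i.e.
`q^pos_{i,1} ≥ q^pos_{i,2} ≥ … ≥ q^pos_{i,m}`. -/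
theorem stmt12 (n m : ℕ) (i : Fin n) (p : Fin m ≃ Fin m) (k l : Fin m) (hkl : k ≤ l) :
    interim i p m (p l) ≤ interim i p m (p k) := by
  unfold interim
  refine mul_le_mul_of_nonneg_left ?_ (by positivity)
  let e : ({i' : Fin n // i' ≠ i} → (Fin m ≃ Fin m)) ≃ ({i' : Fin n // i' ≠ i} → (Fin m ≃ Fin m)) :=
    Equiv.piCongrRight fun _ => Equiv.equivCongr (Equiv.refl _) (Equiv.swap (p k) (p l))
  conv_rhs => rw [← Equiv.sum_comp e]
  refine Finset.sum_le_sum fun po _ => ?_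
  split_ifs with h₁ h₂
  · exact le_rfl
  · refine absurd ?_ h₂
    have := rrAlloc_swap (pr := fun i' => if h : i' = i then p else po ⟨i', h⟩)
      (pr' := fun i' => if h : i' = i then p else e po ⟨i', h⟩)
      (mr := fun i' => if i' = i then m else m) (i := i) hkl (by simp) (by simp)
      (fun t ht => by ext x; simp [ht, e]) (by simpa using h₁)
    simpa using this
  · exact zero_le_one
  · exact le_rfl
end

section
/- Let f : ℝ²_{≥0} → ℝ be anonymous, strictly monotone, and satisfy the Pigou-Dalton principle, and let 0 < b < y < 1. Among the four utility profiles (1, 0), (0, 1), (b, 1 - y), (1 - b, y) — the profiles attainable by the four allocations of two items to agents with valuations (b, 1 - b) and (y, 1 - y) — the value f(1 - b, y) is the strict maximum: f(1 - b, y) > f(1, 0), f(1 - b, y) > f(0, 1), and f(1 - b, y) > f(b, 1 - y). -/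
/-- The normalized valuation `(t, 1 - t)` over the two items. -/
noncomputable def val2 (t : ℝ) : Fin 2 → ℝ := fun j => if j = 0 then t else 1 - t

/-- Utility of a bundle of (some of) the two items under the valuation `(t, 1 - t)`. -/
noncomputable def util2 (t : ℝ) (a : Fin 2 → Bool) : ℝ :=
  ∑ j : Fin 2, if a j then val2 t j else 0

/-- An allocation of the two items among the two agents: each item goes to exactly one agent. -/
def IsAlloc2 (a : Fin 2 → Fin 2 → Bool) : Prop :=
  ∀ j : Fin 2, ∃! i : Fin 2, a i j = true

/-- `f` is anonymous (symmetric) on nonnegative utility profiles. -/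
def Anonymous (f : ℝ → ℝ → ℝ) : Prop :=
  ∀ a b : ℝ, 0 ≤ a → 0 ≤ b → f a b = f b a

/-- `f` is strictly monotone on nonnegative utility profiles: coordinatewise weakly larger
and not equal implies strictly larger welfare. -/
def StrictlyMonotoneWelfare (f : ℝ → ℝ → ℝ) : Prop :=
  ∀ a b a' b' : ℝ, 0 ≤ a' → 0 ≤ b' → a' ≤ a → b' ≤ b → (a, b) ≠ (a', b') → f a' b' < f a b

/-- The Pigou–Dalton principle on nonnegative utility profiles: a mean-preserving
reduction of inequality between two agents weakly increases welfare. -/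
def PigouDalton (f : ℝ → ℝ → ℝ) : Prop :=
  ∀ x1 x2 y1 y2 : ℝ, 0 ≤ x2 → x1 + x2 = y1 + y2 → x2 < x1 → y1 < x1 → x2 < y1 →
    f x1 x2 ≤ f y1 y2

/-- Let `f` be anonymous, strictly monotone, and Pigou–Dalton, and let `0 < b < y < 1`.
Among the four utility profiles `(1,0), (0,1), (b, 1-y), (1-b, y)` attainable by the four
allocations of two items to agents with valuations `(b, 1-b)` and `(y, 1-y)`, the value
`f (1-b) y` is the strict maximum. -/
theorem stmt14 (f : ℝ → ℝ → ℝ) (hanon : Anonymous f)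
    (hmono : StrictlyMonotoneWelfare f) (hpd : PigouDalton f)
    (b y : ℝ) (hb : 0 < b) (hby : b < y) (hy : y < 1) :
    f 1 0 < f (1 - b) y ∧ f 0 1 < f (1 - b) y ∧ f b (1 - y) < f (1 - b) y := by
  have h_one_zero : f 1 0 < f (1 - b) y :=
    (hpd 1 0 (1 - y) y le_rfl (by ring) one_pos (by linarith) (by linarith)).trans_lt
      (hmono _ _ _ _ (by linarith) (by linarith) (by linarith) le_rfl
        fun h => by linarith [congrArg Prod.fst h])
  refine ⟨h_one_zero, hanon 0 1 le_rfl zero_le_one ▸ h_one_zero, ?_⟩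
  rw [hanon b (1 - y) hb.le (by linarith)]
  exact hmono _ _ _ _ (by linarith) hb.le (by linarith) hby.le
    fun h => by linarith [congrArg Prod.snd h]
end

section
/- Let μ be a finite atomless Borel measure on [0,1], let X ⊆ [0,1] be a Lebesgue-measurable set, and let k ≥ 1 be an integer. Then there exists a partition of X into k pairwise disjoint measurable sets C¹, …, C^k with union X such that all pieces have equal Lebesgue measure (λ(C^i) = λ(X)/k for all i) and equal μ-measure (μ(C^i) = μ(X)/k for all i). -/
open MeasureTheory

/-- Discrete averaging and the intermediate value theorem: a continuous function on `[0, k]` has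
a chord of horizontal length `1` realising the average slope. -/
lemma exists_unit_chord_eq_average (k : ℕ) (hk : 1 ≤ k) (H : ℝ → ℝ)
    (hH : ContinuousOn H (Set.Icc 0 k)) :
    ∃ s : ℝ, 0 ≤ s ∧ s + 1 ≤ k ∧ H (s + 1) - H s = (H k - H 0) / k := by
  have hk0 : (0 : ℝ) < k := by exact_mod_cast hk
  set g : ℝ → ℝ := fun s => H (s + 1) - H s with hg
  have hcont : ContinuousOn g (Set.Icc 0 ((k : ℝ) - 1)) := by
    refine ContinuousOn.sub (hH.comp (by fun_prop) ?_) (hH.mono ?_)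
    · rintro s ⟨h0, h1⟩
      exact ⟨by linarith, by linarith⟩
    · exact Set.Icc_subset_Icc_right (by linarith)
  have hsum : ∑ i ∈ Finset.range k, g i = ∑ _i ∈ Finset.range k, (H k - H 0) / k := by
    have h := Finset.sum_range_sub (fun i : ℕ => H i) k
    push_cast at h
    rw [hg, h, Finset.sum_const, Finset.card_range, nsmul_eq_mul]
    field_simp
  have hne : (Finset.range k).Nonempty := Finset.nonempty_range_iff.2 (by omega)
  have hmem : ∀ i ∈ Finset.range k, (i : ℝ) ∈ Set.Icc 0 ((k : ℝ) - 1) := by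
    intro i hi
    have h : ((i + 1 : ℕ) : ℝ) ≤ k := by exact_mod_cast Finset.mem_range.1 hi
    push_cast at h
    exact ⟨Nat.cast_nonneg i, by linarith⟩
  obtain ⟨i, hi, hile⟩ := Finset.exists_le_of_sum_le hne hsum.le
  obtain ⟨j, hj, hjle⟩ := Finset.exists_le_of_sum_le hne hsum.ge
  obtain ⟨s, hs, hseq⟩ := isPreconnected_Icc.intermediate_value (hmem i hi) (hmem j hj) hcont
    ⟨hile, hjle⟩
  exact ⟨s, hs.1, by linarith [hs.2], hseq⟩

lemma measureReal_Ioc_eq_sub (μ : Measure ℝ) [IsFiniteMeasure μ] {c x y : ℝ} (hcx : c ≤ x)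
    (hxy : x ≤ y) : μ.real (Set.Ioc x y) = μ.real (Set.Ioc c y) - μ.real (Set.Ioc c x) := by
  rw [← Set.Ioc_union_Ioc_eq_Ioc hcx hxy,
    measureReal_union (Set.Ioc_disjoint_Ioc_of_le le_rfl) measurableSet_Ioc]
  ring

lemma abs_measureReal_Ioc_sub_le {μ ν : Measure ℝ} [IsFiniteMeasure μ] [IsFiniteMeasure ν]
    (hμν : μ ≤ ν) {c x y : ℝ} (hx : c ≤ x) (hy : c ≤ y) :
    |μ.real (Set.Ioc c y) - μ.real (Set.Ioc c x)| ≤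
      |ν.real (Set.Ioc c y) - ν.real (Set.Ioc c x)| := by
  wlog h : x ≤ y generalizing x y
  · rw [abs_sub_comm, abs_sub_comm (ν.real _)]
    exact this hy hx (le_of_not_ge h)
  rw [← measureReal_Ioc_eq_sub μ hx h, ← measureReal_Ioc_eq_sub ν hx h,
    abs_of_nonneg measureReal_nonneg, abs_of_nonneg measureReal_nonneg]
  exact ENNReal.toReal_mono (measure_ne_top _ _) (hμν _)

lemma continuousOn_measureReal_Ioc (μ : Measure ℝ) [IsFiniteMeasure μ] [NullSingletonClass μ] (c d : ℝ) :
    ContinuousOn (fun x => μ.real (Set.Ioc c x)) (Set.Icc c d) := by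
  have h := intervalIntegral.continuousOn_primitive (μ := μ) (f := fun _ : ℝ => (1 : ℝ))
    (a := c) (b := d) (integrable_const _)
  simpa using h

/-- Two finite atomless measures admit a common interval carrying the fraction `1 / k` of each. -/
lemma exists_Ioc_measureReal_eq_div (μ ν : Measure ℝ) [IsFiniteMeasure μ] [IsFiniteMeasure ν]
    [NullSingletonClass μ] [NullSingletonClass ν] {c d : ℝ} (hcd : c ≤ d) (k : ℕ) (hk : 1 ≤ k) :
    ∃ x y : ℝ, c ≤ x ∧ y ≤ d ∧
      μ.real (Set.Ioc x y) = μ.real (Set.Ioc c d) / k ∧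
      ν.real (Set.Ioc x y) = ν.real (Set.Ioc c d) / k := by
  have hk0 : (0 : ℝ) < k := by exact_mod_cast hk
  set m : Measure ℝ := μ + ν with hm
  have : NullSingletonClass m := ⟨fun x => by simp [hm]⟩
  set a : ℝ := m.real (Set.Ioc c d) with ha
  have ha0 : 0 ≤ a := measureReal_nonneg
  have hquantile : ∀ s : ℝ, ∃ x, s ∈ Set.Icc (0 : ℝ) k →
      x ∈ Set.Icc c d ∧ m.real (Set.Ioc c x) = s * (a / k) := by
    intro s
    by_cases hs : s ∈ Set.Icc (0 : ℝ) k
    · have hmem : s * (a / k) ∈ Set.Icc (m.real (Set.Ioc c c)) (m.real (Set.Ioc c d)) := by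
        refine ⟨by simpa using mul_nonneg hs.1 (by positivity), ?_⟩
        calc s * (a / k) ≤ k * (a / k) := by gcongr; exact hs.2
          _ = a := by field_simp
      obtain ⟨x, hx, hxs⟩ := intermediate_value_Icc hcd (continuousOn_measureReal_Ioc m c d) hmem
      exact ⟨x, fun _ => ⟨hx, hxs⟩⟩
    · exact ⟨0, fun h => absurd h hs⟩
  choose q hq using hquantile
  have hνm : ν ≤ m := Measure.le_add_left le_rfl
  set H : ℝ → ℝ := fun s => ν.real (Set.Ioc c (q s)) with hH
  have hcont : ContinuousOn H (Set.Icc 0 k) := by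
    refine LipschitzOnWith.continuousOn (K := (a / k).toNNReal)
      (LipschitzOnWith.of_dist_le_mul fun s hs t ht => ?_)
    rw [Real.coe_toNNReal _ (by positivity), Real.dist_eq, Real.dist_eq]
    refine (abs_measureReal_Ioc_sub_le hνm (hq t ht).1.1 (hq s hs).1.1).trans_eq ?_
    rw [(hq s hs).2, (hq t ht).2, ← sub_mul, abs_mul, abs_of_nonneg (by positivity : 0 ≤ a / k),
      mul_comm]
  have hH0 : H 0 = 0 := by
    have h0 : (0 : ℝ) ∈ Set.Icc (0 : ℝ) k := ⟨le_rfl, hk0.le⟩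
    have h := abs_measureReal_Ioc_sub_le hνm le_rfl (hq 0 h0).1.1
    rw [(hq 0 h0).2] at h
    simpa using h
  have hHk : H k = ν.real (Set.Ioc c d) := by
    have h0 : (k : ℝ) ∈ Set.Icc (0 : ℝ) k := ⟨hk0.le, le_rfl⟩
    have h := abs_measureReal_Ioc_sub_le hνm hcd (hq k h0).1.1
    rw [(hq k h0).2, mul_div_cancel₀ _ hk0.ne', ← ha, sub_self, abs_zero] at h
    exact sub_eq_zero.1 (abs_nonpos_iff.1 h)
  obtain ⟨s, hs0, hs1, hs⟩ := exists_unit_chord_eq_average k hk H hcont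
  rw [hH0, hHk, sub_zero] at hs
  obtain ⟨⟨hx, -⟩, hxm⟩ := hq s ⟨hs0, by linarith⟩
  obtain ⟨⟨hy, hyd⟩, hym⟩ := hq (s + 1) ⟨by linarith, hs1⟩
  have hdiff : m.real (Set.Ioc c (q (s + 1))) - m.real (Set.Ioc c (q s)) = a / k := by
    rw [hxm, hym]; ring
  have hmν : m.real (Set.Ioc (q s) (q (s + 1))) = a / k ∧
      ν.real (Set.Ioc (q s) (q (s + 1))) = ν.real (Set.Ioc c d) / k := by
    rcases le_total (q s) (q (s + 1)) with hle | hle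
    · rw [measureReal_Ioc_eq_sub m hx hle, measureReal_Ioc_eq_sub ν hx hle]
      exact ⟨hdiff, hs⟩
    · have hm0 := measureReal_Ioc_eq_sub m hy hle
      have hmn : 0 ≤ m.real (Set.Ioc (q (s + 1)) (q s)) := measureReal_nonneg
      have hak : 0 ≤ a / k := by positivity
      have hz : a / k = 0 := by linarith
      have h := abs_measureReal_Ioc_sub_le hνm hx hy
      rw [hdiff, hz, abs_zero] at h
      have h' := abs_nonpos_iff.1 h
      rw [Set.Ioc_eq_empty_of_le hle, hz, ← hs]
      exact ⟨by simp, by simpa using h'.symm⟩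
  refine ⟨q s, q (s + 1), hx, hyd, ?_, hmν.2⟩
  have h := hmν.1
  rw [ha, hm, measureReal_add_apply, measureReal_add_apply, hmν.2, add_div] at h
  linarith

/-- Two finite atomless measures on the line admit a simultaneous equipartition of every bounded
measurable set. -/
lemma exists_equipartition_measureReal (μ ν : Measure ℝ) [IsFiniteMeasure μ] [IsFiniteMeasure ν]
    [NullSingletonClass μ] [NullSingletonClass ν] {c d : ℝ} (hcd : c ≤ d) (n : ℕ) (X : Set ℝ)
    (hX : MeasurableSet X) (hXsub : X ⊆ Set.Ioc c d) :
    ∃ C : Fin (n + 1) → Set ℝ,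
      (∀ i, MeasurableSet (C i)) ∧
      (∀ i j, i ≠ j → Disjoint (C i) (C j)) ∧
      (⋃ i, C i) = X ∧
      (∀ i, μ.real (C i) = μ.real X / (n + 1)) ∧
      (∀ i, ν.real (C i) = ν.real X / (n + 1)) := by
  induction n generalizing X with
  | zero =>
    exact ⟨fun _ => X, fun _ => hX, fun i j h => absurd (Fin.subsingleton_one.elim i j) h,
      Set.iUnion_const X, by simp, by simp⟩
  | succ n ih =>
    obtain ⟨x, y, -, -, hμ, hν⟩ := exists_Ioc_measureReal_eq_div (μ.restrict X) (ν.restrict X)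
      hcd (n + 2) (by omega)
    simp only [measureReal_restrict_apply measurableSet_Ioc,
      Set.inter_eq_right.2 hXsub] at hμ hν
    set A := Set.Ioc x y ∩ X with hA
    have hAm : MeasurableSet A := measurableSet_Ioc.inter hX
    have hAX : A ⊆ X := Set.inter_subset_right
    obtain ⟨C, hCm, hCd, hCU, hCμ, hCν⟩ := ih (X \ A) (hX.diff hAm)
      (Set.sdiff_subset.trans hXsub)
    have hAC : ∀ i, Disjoint A (C i) := fun i =>
      Set.disjoint_sdiff_right.mono_right (hCU ▸ Set.subset_iUnion C i)
    rw [measureReal_sdiff hAX hAm, hμ] at hCμ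
    rw [measureReal_sdiff hAX hAm, hν] at hCν
    push_cast at hμ hν hCμ hCν ⊢
    have hfrac : ∀ t : ℝ, (t - t / (n + 2)) / (n + 1) = t / (n + 1 + 1) := by
      intro t
      have h1 : (n : ℝ) + 1 ≠ 0 := by positivity
      have h2 : (n : ℝ) + 2 ≠ 0 := by positivity
      rw [add_assoc (n : ℝ), one_add_one_eq_two]
      field_simp
      ring
    refine ⟨Fin.cons A C, ?_, ?_, ?_, ?_, ?_⟩
    · exact Fin.cases hAm hCm
    · intro i j
      refine Fin.cases ?_ (fun i => ?_) i <;> refine Fin.cases ?_ (fun j => ?_) j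
      · simp
      · exact fun _ => by simpa using hAC j
      · exact fun _ => by simpa using (hAC i).symm
      · simpa using hCd i j
    · rw [← Set.union_sdiff_cancel hAX, ← hCU]
      ext z
      simp [Fin.exists_fin_succ]
    · refine Fin.cases ?_ fun i => ?_
      · rw [Fin.cons_zero, hμ, add_assoc, one_add_one_eq_two]
      · rw [Fin.cons_succ, hCμ, hfrac]
    · refine Fin.cases ?_ fun i => ?_
      · rw [Fin.cons_zero, hν, add_assoc, one_add_one_eq_two]
      · rw [Fin.cons_succ, hCν, hfrac]

lemma measure_eq_div_of_measureReal_eq_div {α : Type*} [MeasurableSpace α] {μ : Measure α}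
    {s t : Set α} {k : ℕ} (hk : k ≠ 0) (hs : μ s ≠ ⊤) (ht : μ t ≠ ⊤)
    (h : μ.real s = μ.real t / k) : μ s = μ t / k := by
  rw [← ENNReal.toReal_eq_toReal_iff' hs (ENNReal.div_ne_top ht (by exact_mod_cast hk)),
    ENNReal.toReal_div, ENNReal.toReal_natCast]
  exact h

/-- SplitEqual: let `μ` be a finite atomless Borel measure concentrated on `[0,1]`, let
`X ⊆ [0,1]` be measurable, and let `k ≥ 1`.  Then `X` can be partitioned into `k`
pairwise disjoint measurable pieces, all of the same Lebesgue measure `λ(X)/k` and the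
same `μ`-measure `μ(X)/k`. -/
theorem stmt17 (μ : Measure ℝ) (hfin : IsFiniteMeasure μ)
    (hatomless : ∀ x : ℝ, μ {x} = 0) (hsupp : μ (Set.Icc (0 : ℝ) 1)ᶜ = 0)
    (X : Set ℝ) (hXmeas : MeasurableSet X) (hXsub : X ⊆ Set.Icc (0 : ℝ) 1)
    (k : ℕ) (hk : 1 ≤ k) :
    ∃ C : Fin k → Set ℝ,
      (∀ i, MeasurableSet (C i)) ∧
      (∀ i j, i ≠ j → Disjoint (C i) (C j)) ∧
      (⋃ i, C i) = X ∧
      (∀ i, volume (C i) = volume X / k) ∧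
      (∀ i, μ (C i) = μ X / k) := by
  have : NullSingletonClass μ := ⟨hatomless⟩
  obtain ⟨n, rfl⟩ : ∃ n, k = n + 1 := ⟨k - 1, by omega⟩
  have hXfin : volume X ≠ ⊤ := measure_ne_top_of_subset hXsub (by simp)
  have hXIoc : X ⊆ Set.Ioc (-1 : ℝ) 1 := hXsub.trans (Set.Icc_subset_Ioc_iff zero_le_one |>.2
    ⟨by norm_num, le_rfl⟩)
  obtain ⟨C, hCm, hCd, hCU, hCvol, hCμ⟩ := exists_equipartition_measureReal
    (volume.restrict (Set.Icc (0 : ℝ) 1)) μ (by norm_num : (-1 : ℝ) ≤ 1) n X hXmeas hXIoc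
  have hCX : ∀ i, C i ⊆ X := fun i => hCU ▸ Set.subset_iUnion C i
  refine ⟨C, hCm, hCd, hCU, fun i => ?_, fun i => ?_⟩
  · refine measure_eq_div_of_measureReal_eq_div n.succ_ne_zero
      (measure_ne_top_of_subset (hCX i) hXfin) hXfin ?_
    have h := hCvol i
    rw [measureReal_restrict_apply (hCm i), measureReal_restrict_apply hXmeas,
      Set.inter_eq_left.2 hXsub, Set.inter_eq_left.2 ((hCX i).trans hXsub)] at h
    exact_mod_cast h
  · refine measure_eq_div_of_measureReal_eq_div n.succ_ne_zero (measure_ne_top _ _)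
      (measure_ne_top _ _) ?_
    exact_mod_cast hCμ i
end
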